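/- arXiv:2601.12608 — 2 statements merged into one kernel-verified Lean document; each statement's English description precedes it below -/
import Mathlib

section
/- Let n ≥ 1, X a nonzero complex Banach space, λ > 1, 1 ≤ p < ∞ and 1 ≤ q ≤ ∞. Then, for U the identity operator on X, B_λ(B_{ℓⁿ_q},p,X) ≥ (λ^p − 1)^{1/p}/λ · n^{−(1/p + 1/q)} (with 1/q := 0 when q = ∞). -/
open scoped ENNReal Pointwise
open Filter

noncomputable section

namespace BohrPaper

/-- The monomial `z^α = z₁^{α₁} ⋯ z_n^{α_n}`. -/
def mpow {n : ℕ} (z : Fin n → ℂ) (α : Fin n → ℕ) : ℂ := ∏ j, z j ^ α j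

/-- A complete Reinhardt domain in `ℂⁿ`: nonempty, open, connected and closed under
componentwise decrease of moduli. -/
def IsCompleteReinhardt {n : ℕ} (Ω : Set (Fin n → ℂ)) : Prop :=
  IsOpen Ω ∧ IsConnected Ω ∧
    ∀ z ∈ Ω, ∀ w : Fin n → ℂ, (∀ j, ‖w j‖ ≤ ‖z j‖) → w ∈ Ω

/-- `S(Ω₁, Ω₂) := inf {s > 0 : Ω₁ ⊆ s·Ω₂}`. -/
def SRatio {n : ℕ} (Ω₁ Ω₂ : Set (Fin n → ℂ)) : ℝ :=
  sInf {s : ℝ | 0 < s ∧ Ω₁ ⊆ s • Ω₂}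

/-- The open unit polydisc `𝔻ⁿ`. -/
def polydisc (n : ℕ) : Set (Fin n → ℂ) := {z | ∀ j, ‖z j‖ < 1}

/-- The sup-norm of `f` over `Ω`. -/
def supNorm {n : ℕ} {E : Type*} [Norm E] (Ω : Set (Fin n → ℂ)) (f : (Fin n → ℂ) → E) : ℝ :=
  ⨆ z ∈ Ω, ‖f z‖

/-- The `ℓ_q`-norm on `ℂⁿ` (`q = ∞` gives the max norm). -/
def lqNorm (n : ℕ) (q : ℝ≥0∞) (z : Fin n → ℂ) : ℝ :=
  if q = ∞ then ⨆ j, ‖z j‖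
  else (∑ j, ‖z j‖ ^ q.toReal) ^ (1 / q.toReal)

/-- The open unit ball of `ℓⁿ_q`. -/
def lqBall (n : ℕ) (q : ℝ≥0∞) : Set (Fin n → ℂ) := {z | lqNorm n q z < 1}

/-- `N` is a norm on `ℂⁿ`. -/
def IsNorm {n : ℕ} (N : (Fin n → ℂ) → ℝ) : Prop :=
  (∀ z, 0 ≤ N z) ∧ (∀ z, N z = 0 → z = 0) ∧
    (∀ (c : ℂ) (z), N (c • z) = ‖c‖ * N z) ∧ ∀ z w, N (z + w) ≤ N z + N w

/-- The canonical basis of `ℂⁿ` is normalized and 1-unconditional for the norm `N`. -/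
def IsNormalized1Unconditional {n : ℕ} (N : (Fin n → ℂ) → ℝ) : Prop :=
  (∀ k, N (fun j => if j = k then 1 else 0) = 1) ∧
    ∀ ε μ : Fin n → ℂ, (∀ j, ‖ε j‖ ≤ 1) → N (fun j => ε j * μ j) ≤ N μ

/-- Open unit ball of the norm `N`. -/
def unitBall {n : ℕ} (N : (Fin n → ℂ) → ℝ) : Set (Fin n → ℂ) := {z | N z < 1}

/-- Operator norm of the identity map `(ℂⁿ, N₁) → (ℂⁿ, N₂)`. -/
def idNorm {n : ℕ} (N₁ N₂ : (Fin n → ℂ) → ℝ) : ℝ :=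
  sInf {c : ℝ | 0 ≤ c ∧ ∀ z, N₂ z ≤ c * N₁ z}

/-- `b_m(Ω) = (inf_{|α| = m} sup_{z ∈ Ω} |z^α|)^{-1/m}`. -/
def bCoef {n : ℕ} (Ω : Set (Fin n → ℂ)) (m : ℕ) : ℝ :=
  (sInf ((fun α : Fin n → ℕ => ⨆ z ∈ Ω, ‖mpow z α‖) ''
      {α : Fin n → ℕ | ∑ j, α j = m})) ^ (-(1 / (m : ℝ)))

section Holomorphic

variable {n : ℕ} {X : Type*} [NormedAddCommGroup X] [NormedSpace ℂ X]
  {Y : Type*} [NormedAddCommGroup Y] [NormedSpace ℂ Y]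

/-- `f` is a bounded holomorphic `X`-valued function on `Ω` with monomial expansion
`f = Σ a_α z^α` converging locally uniformly on `Ω`. -/
def IsBddHolomorphic (Ω : Set (Fin n → ℂ)) (f : (Fin n → ℂ) → X)
    (a : (Fin n → ℕ) → X) : Prop :=
  TendstoLocallyUniformlyOn
    (fun (s : Finset (Fin n → ℕ)) z => ∑ α ∈ s, mpow z α • a α) f atTop Ω ∧
  BddAbove ((fun z => ‖f z‖) '' Ω)

/-- The left-hand side `Σ_α sup_{z ∈ rΩ} ‖U a_α‖^p |z^α|^p` of the second Bohr inequality
for holomorphic functions, valued in `ℝ≥0∞`. -/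
def holBohrSum (Ω : Set (Fin n → ℂ)) (r p : ℝ) (U : X →L[ℂ] Y)
    (a : (Fin n → ℕ) → X) : ℝ≥0∞ :=
  ∑' α : Fin n → ℕ, ⨆ z ∈ r • Ω,
    ENNReal.ofReal (‖U (a α)‖ ^ p * ‖mpow z α‖ ^ p)

/-- The second `λ`-powered Bohr radius `B_λ(Ω, p, U)` for holomorphic functions. -/
def secondBohrHol (Ω : Set (Fin n → ℂ)) (p lam : ℝ) (U : X →L[ℂ] Y) : ℝ :=
  sSup {r : ℝ | r ∈ Set.Icc (0 : ℝ) 1 ∧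
    ∀ (f : (Fin n → ℂ) → X) (a : (Fin n → ℕ) → X), IsBddHolomorphic Ω f a →
      holBohrSum Ω r p U a ≤ ENNReal.ofReal (lam ^ p * supNorm Ω f ^ p)}

/-- The first `λ`-powered Bohr radius `K_λ(Ω, p, U)` for holomorphic functions. -/
def firstBohrHol (Ω : Set (Fin n → ℂ)) (p lam : ℝ) (U : X →L[ℂ] Y) : ℝ :=
  sSup {r : ℝ | r ∈ Set.Icc (0 : ℝ) 1 ∧
    ∀ (f : (Fin n → ℂ) → X) (a : (Fin n → ℕ) → X), IsBddHolomorphic Ω f a →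
      (⨆ z ∈ r • Ω, ∑' α : Fin n → ℕ,
        ENNReal.ofReal (‖U (a α)‖ ^ p * ‖mpow z α‖ ^ p)) ≤
        ENNReal.ofReal (lam ^ p * supNorm Ω f ^ p)}

end Holomorphic

/-- Averaging against a character of the group of `N`-th roots of unity isolates a coefficient. -/
lemma sum_roots_of_unity {N : ℕ} {ω : ℂ} (hω : IsPrimitiveRoot ω N) {a b : ℕ}
    (ha : a < N) (hb : b < N) :
    ∑ k : Fin N, (ω ^ (N - a + b)) ^ (k : ℕ) = if b = a then (N : ℂ) else 0 := by
  rw [Fin.sum_univ_eq_sum_range (fun k => (ω ^ (N - a + b)) ^ k)]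
  split_ifs with h
  · subst h
    simp [Nat.sub_add_cancel hb.le, hω.pow_eq_one]
  · have hne : ω ^ (N - a + b) ≠ 1 := by
      rw [Ne, hω.pow_eq_one_iff_dvd]
      rintro ⟨c, hc⟩
      have hc0 : 0 < c := by
        rcases Nat.eq_zero_or_pos c with rfl | h0
        · omega
        · exact h0
      have hc2 : c < 2 := by
        by_contra hcon
        have : N * 2 ≤ N * c := Nat.mul_le_mul_left _ (by omega)
        omega
      obtain rfl : c = 1 := by omega
      omega
    have hz := mul_geom_sum (ω ^ (N - a + b)) N
    rw [← pow_mul, mul_comm _ N, pow_mul, hω.pow_eq_one, one_pow, sub_self] at hz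
    exact (mul_eq_zero.mp hz).resolve_left (sub_ne_zero.mpr hne)

/-- Cauchy's estimate for polynomials with vector coefficients on a torus. -/
lemma norm_coeff_le_of_torus {n : ℕ} {X : Type*} [NormedAddCommGroup X] [NormedSpace ℂ X]
    (a : (Fin n → ℕ) → X) (s : Finset (Fin n → ℕ)) {α : Fin n → ℕ} (hα : α ∈ s)
    (z : Fin n → ℂ) {C : ℝ}
    (hC : ∀ w : Fin n → ℂ, (∀ j, ‖w j‖ = ‖z j‖) → ‖∑ β ∈ s, mpow w β • a β‖ ≤ C) :
    ‖mpow z α • a α‖ ≤ C := by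
  obtain ⟨N, hN⟩ : ∃ N : ℕ, 0 < N ∧ ∀ β ∈ s, ∀ j, β j < N := by
    refine ⟨s.sup (fun β => ∑ j, β j) + 1, Nat.succ_pos _, fun β hβ j => ?_⟩
    have h1 : β j ≤ ∑ j, β j := Finset.single_le_sum (fun _ _ => Nat.zero_le _) (Finset.mem_univ j)
    have h2 := Finset.le_sup (f := fun β : Fin n → ℕ => ∑ j, β j) hβ
    omega
  obtain ⟨hN0, hN⟩ := hN
  set ω : ℂ := Complex.exp (2 * Real.pi * Complex.I / N)
  have hω : IsPrimitiveRoot ω N := Complex.isPrimitiveRoot_exp N hN0.ne'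
  have hω1 : ‖ω‖ = 1 := hω.norm'_eq_one hN0.ne'
  let w : (Fin n → Fin N) → Fin n → ℂ := fun k j => ω ^ (k j : ℕ) * z j
  let χ : (Fin n → Fin N) → ℂ := fun k => ∏ j, (ω ^ (N - α j)) ^ (k j : ℕ)
  have hterm : ∀ k β, χ k * mpow (w k) β =
      (∏ j, (ω ^ (N - α j + β j)) ^ (k j : ℕ)) * mpow z β := by
    intro k β
    simp only [χ, w, mpow, ← Finset.prod_mul_distrib]
    refine Finset.prod_congr rfl fun j _ => ?_
    ring
  have hchar : ∀ β ∈ s, ∑ k, χ k * mpow (w k) β =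
      if β = α then (N : ℂ) ^ n * mpow z β else 0 := by
    intro β hβ
    simp only [hterm, ← Finset.sum_mul]
    have hsum : ∑ k : Fin n → Fin N, ∏ j, (ω ^ (N - α j + β j)) ^ (k j : ℕ) =
        ∏ j, ∑ k : Fin N, (ω ^ (N - α j + β j)) ^ (k : ℕ) := by
      rw [Finset.prod_univ_sum, Fintype.piFinset_univ]
    rw [hsum, Finset.prod_congr rfl fun j _ => sum_roots_of_unity hω (hN α hα j) (hN β hβ j)]
    split_ifs with h
    · subst h
      simp
    · obtain ⟨j, hj⟩ := Function.ne_iff.mp h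
      rw [Finset.prod_eq_zero (Finset.mem_univ j) (if_neg hj), zero_mul]
  have havg : ∑ k, χ k • ∑ β ∈ s, mpow (w k) β • a β = (N : ℂ) ^ n • mpow z α • a α := by
    simp only [Finset.smul_sum, smul_smul]
    rw [Finset.sum_comm]
    simp only [← Finset.sum_smul]
    rw [Finset.sum_congr rfl fun β hβ => by rw [hchar β hβ]]
    simp [ite_smul, hα]
  have hle : ‖(N : ℂ) ^ n • mpow z α • a α‖ ≤ (N : ℝ) ^ n * C := by
    rw [← havg]
    refine (norm_sum_le_of_le (f := fun k => χ k • ∑ β ∈ s, mpow (w k) β • a β)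
      (n := fun _ => C) _ fun k _ => ?_).trans (by simp)
    rw [norm_smul]
    have hχ : ‖χ k‖ = 1 := by simp [χ, norm_prod, hω1]
    rw [hχ, one_mul]
    exact hC _ fun j => by simp [w, hω1]
  rw [norm_smul, norm_pow, Complex.norm_natCast] at hle
  exact le_of_mul_le_mul_left hle (by positivity)

/-- A bounded function is bounded by its `supNorm`. -/
lemma norm_le_supNorm {n : ℕ} {E : Type*} [NormedAddCommGroup E] {Ω : Set (Fin n → ℂ)}
    {f : (Fin n → ℂ) → E} (hf : BddAbove ((fun z => ‖f z‖) '' Ω)) {z : Fin n → ℂ}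
    (hz : z ∈ Ω) : ‖f z‖ ≤ supNorm Ω f := by
  obtain ⟨B, hB⟩ := hf
  have hbdd : BddAbove (Set.range fun z => ⨆ _ : z ∈ Ω, ‖f z‖) := by
    refine ⟨max B 0, ?_⟩
    rintro _ ⟨w, rfl⟩
    by_cases hw : w ∈ Ω
    · simpa [hw] using Or.inl (hB ⟨w, hw, rfl⟩)
    · simp [hw]
  have h := le_ciSup hbdd z
  simpa [hz, supNorm] using h

/-- `supNorm` is nonnegative. -/
lemma supNorm_nonneg {n : ℕ} {E : Type*} [NormedAddCommGroup E] (Ω : Set (Fin n → ℂ))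
    (f : (Fin n → ℂ) → E) : 0 ≤ supNorm Ω f :=
  Real.iSup_nonneg fun _ => Real.iSup_nonneg fun _ => norm_nonneg _

/-- Cauchy's estimate for the monomial coefficients of a bounded holomorphic function on a
domain that is invariant under rotations of the coordinates. -/
lemma IsBddHolomorphic.norm_coeff_le {n : ℕ} {X : Type*} [NormedAddCommGroup X]
    [NormedSpace ℂ X] {Ω : Set (Fin n → ℂ)} {f : (Fin n → ℂ) → X} {a : (Fin n → ℕ) → X}
    (hf : IsBddHolomorphic Ω f a) {z : Fin n → ℂ}
    (hΩ : ∀ w : Fin n → ℂ, (∀ j, ‖w j‖ = ‖z j‖) → w ∈ Ω) (α : Fin n → ℕ) :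
    ‖a α‖ * ‖mpow z α‖ ≤ supNorm Ω f := by
  set K : Set (Fin n → ℂ) := Set.univ.pi fun j => Metric.sphere 0 ‖z j‖
  have hK : IsCompact K := isCompact_univ_pi fun j => isCompact_sphere _ _
  have hmem : ∀ w : Fin n → ℂ, (∀ j, ‖w j‖ = ‖z j‖) → w ∈ K := fun w hw j _ => by
    simpa using hw j
  have hKΩ : K ⊆ Ω := fun w hw => hΩ w fun j => by simpa using hw j (Set.mem_univ j)
  have hunif := (tendstoLocallyUniformlyOn_iff_tendstoUniformlyOn_of_compact hK).mp
    (hf.1.mono hKΩ)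
  rw [Metric.tendstoUniformlyOn_iff] at hunif
  refine le_of_forall_pos_le_add fun ε hε => ?_
  obtain ⟨s, hs, hαs⟩ := ((hunif ε hε).and (eventually_ge_atTop {α})).exists
  rw [mul_comm, ← norm_smul]
  refine norm_coeff_le_of_torus a s (Finset.singleton_subset_iff.mp hαs) z fun w hw => ?_
  have h1 := hs w (hmem w hw)
  rw [dist_eq_norm, norm_sub_rev] at h1
  have h2 := norm_le_supNorm hf.2 (hΩ w hw)
  have h3 := norm_le_norm_add_norm_sub' (∑ β ∈ s, mpow w β • a β) (f w)
  linarith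

/-- The multivariate geometric series. -/
lemma tsum_prod_pow (n : ℕ) (x : ℝ≥0∞) :
    ∑' α : Fin n → ℕ, ∏ j, x ^ α j = ((1 - x)⁻¹) ^ n := by
  induction n with
  | zero => simp [tsum_fintype]
  | succ n ih =>
    rw [← (Fin.consEquiv fun _ => ℕ).tsum_eq, ENNReal.tsum_prod']
    simp only [Fin.consEquiv_apply, Fin.prod_univ_succ, Fin.cons_zero, Fin.cons_succ,
      ENNReal.tsum_mul_left, ih, ENNReal.tsum_mul_right, ENNReal.tsum_geometric]
    rw [pow_succ']

/-- Monomials are homogeneous. -/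
lemma mpow_real_smul {n : ℕ} (r : ℝ) (z : Fin n → ℂ) (α : Fin n → ℕ) :
    mpow (r • z) α = (∏ j, (r : ℂ) ^ α j) * mpow z α := by
  simp [mpow, mul_pow, Finset.prod_mul_distrib]

/-- If `n r ^ p ≤ 1 - λ ^ (-p)`, the second Bohr inequality holds at radius `r` on every
domain invariant under rotations of the coordinates. -/
lemma holBohrSum_id_le {n : ℕ} {X : Type*} [NormedAddCommGroup X] [NormedSpace ℂ X]
    {Ω : Set (Fin n → ℂ)}
    (hΩ : ∀ z ∈ Ω, ∀ w : Fin n → ℂ, (∀ j, ‖w j‖ = ‖z j‖) → w ∈ Ω)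
    {r p lam : ℝ} (hr : 0 ≤ r) (hp : 0 < p) (hlam : 0 < lam) (hr1 : r ^ p < 1)
    (hrn : n * r ^ p ≤ 1 - (lam ^ p)⁻¹) {f : (Fin n → ℂ) → X} {a : (Fin n → ℕ) → X}
    (hf : IsBddHolomorphic Ω f a) :
    holBohrSum Ω r p (ContinuousLinearMap.id ℂ X) a ≤
      ENNReal.ofReal (lam ^ p * supNorm Ω f ^ p) := by
  set M := supNorm Ω f
  have hM : 0 ≤ M := supNorm_nonneg Ω f
  have hx : 0 ≤ r ^ p := Real.rpow_nonneg hr p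
  have hL : 0 < lam ^ p := Real.rpow_pos_of_pos hlam p
  have hterm : ∀ α : Fin n → ℕ, (⨆ z ∈ r • Ω,
      ENNReal.ofReal (‖ContinuousLinearMap.id ℂ X (a α)‖ ^ p * ‖mpow z α‖ ^ p)) ≤
      ENNReal.ofReal (M ^ p) * ∏ j, ENNReal.ofReal (r ^ p) ^ α j := by
    intro α
    refine iSup₂_le ?_
    rintro _ ⟨z, hz, rfl⟩
    have hP : ∏ j, ENNReal.ofReal (r ^ p) ^ α j = ENNReal.ofReal ((∏ j, r ^ α j) ^ p) := by
      rw [← Real.finsetProd_rpow _ _ (fun j _ => pow_nonneg hr _),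
        ENNReal.ofReal_prod_of_nonneg (fun j _ => by positivity)]
      refine Finset.prod_congr rfl fun j _ => ?_
      rw [← ENNReal.ofReal_pow hx, ← Real.rpow_natCast, ← Real.rpow_natCast,
        ← Real.rpow_mul hr, ← Real.rpow_mul hr, mul_comm]
    have hP0 : 0 ≤ ∏ j, r ^ α j := Finset.prod_nonneg fun j _ => pow_nonneg hr _
    rw [hP, ← ENNReal.ofReal_mul (by positivity)]
    refine ENNReal.ofReal_le_ofReal ?_
    have hn : ‖∏ j, (r : ℂ) ^ α j‖ = ∏ j, r ^ α j := by
      simp [norm_prod, abs_of_nonneg hr]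
    simp only [ContinuousLinearMap.id_apply, mpow_real_smul, norm_mul, hn]
    rw [← Real.mul_rpow (by positivity) (by positivity), ← Real.mul_rpow hM hP0]
    refine Real.rpow_le_rpow (by positivity) ?_ hp.le
    have hc := hf.norm_coeff_le (hΩ z hz) α
    calc ‖a α‖ * ((∏ j, r ^ α j) * ‖mpow z α‖)
        = (‖a α‖ * ‖mpow z α‖) * ∏ j, r ^ α j := by ring
      _ ≤ M * ∏ j, r ^ α j := by gcongr
  have hbern : (lam ^ p)⁻¹ ≤ (1 - r ^ p) ^ n := by
    have h := one_add_mul_le_pow (a := -r ^ p) (by linarith) n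
    rw [← sub_eq_add_neg] at h
    linarith
  calc holBohrSum Ω r p (ContinuousLinearMap.id ℂ X) a
      ≤ ∑' α : Fin n → ℕ, ENNReal.ofReal (M ^ p) * ∏ j, ENNReal.ofReal (r ^ p) ^ α j :=
        ENNReal.tsum_le_tsum hterm
    _ = ENNReal.ofReal (M ^ p) * ENNReal.ofReal (((1 - r ^ p)⁻¹) ^ n) := by
        rw [ENNReal.tsum_mul_left, tsum_prod_pow,
          ENNReal.ofReal_pow (inv_nonneg.mpr (by linarith)),
          ENNReal.ofReal_inv_of_pos (by linarith), ENNReal.ofReal_sub _ hx, ENNReal.ofReal_one]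
    _ = ENNReal.ofReal (((1 - r ^ p)⁻¹) ^ n * M ^ p) := by
        rw [mul_comm, ENNReal.ofReal_mul (pow_nonneg (inv_nonneg.mpr (by linarith)) n)]
    _ ≤ ENNReal.ofReal (lam ^ p * M ^ p) := by
        refine ENNReal.ofReal_le_ofReal (mul_le_mul_of_nonneg_right ?_ (by positivity))
        rw [inv_pow]
        exact inv_le_of_inv_le₀ hL hbern

/-- The `ℓ_q`-norm depends only on the moduli of the coordinates. -/
lemma lqNorm_congr {n : ℕ} (q : ℝ≥0∞) {z w : Fin n → ℂ} (h : ∀ j, ‖w j‖ = ‖z j‖) :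
    lqNorm n q w = lqNorm n q z := by
  simp [lqNorm, h]

/-- lower bound for the second Bohr radius of `X`-valued holomorphic functions
on `B_{ℓⁿ_q}` for the identity operator on `X`. -/
theorem second_bohr_Hol_lower_bound_id_lq {n : ℕ} (hn : 1 ≤ n)
    {X : Type*} [NormedAddCommGroup X] [NormedSpace ℂ X] [CompleteSpace X] [Nontrivial X]
    (p lam : ℝ) (q : ℝ≥0∞) (hp : 1 ≤ p) (hq : 1 ≤ q) (hlam : 1 < lam) :
    (lam ^ p - 1) ^ (1 / p) / lam * (n : ℝ) ^ (-(1 / p + (1 / q).toReal)) ≤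
      secondBohrHol (lqBall n q) p lam (ContinuousLinearMap.id ℂ X) := by
  have hp0 : 0 < p := by linarith
  have hlam0 : 0 < lam := by linarith
  have hL : 1 < lam ^ p := Real.one_lt_rpow hlam hp0
  have hn1 : (1 : ℝ) ≤ n := by exact_mod_cast hn
  have hn0 : (0 : ℝ) < n := by linarith
  set e : ℝ := 1 / p + (1 / q).toReal with he
  set r : ℝ := (lam ^ p - 1) ^ (1 / p) / lam * (n : ℝ) ^ (-e)
  have hr : 0 ≤ r :=
    mul_nonneg (div_nonneg (Real.rpow_nonneg (by linarith) _) hlam0.le)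
      (Real.rpow_nonneg hn0.le _)
  have hrp : r ^ p = (1 - (lam ^ p)⁻¹) * (n : ℝ) ^ (-e * p) := by
    rw [Real.mul_rpow (div_nonneg (Real.rpow_nonneg (by linarith) _) hlam0.le)
      (Real.rpow_nonneg hn0.le _), Real.div_rpow (Real.rpow_nonneg (by linarith) _) hlam0.le,
      ← Real.rpow_mul (by linarith), ← Real.rpow_mul hn0.le, one_div_mul_cancel hp0.ne',
      Real.rpow_one]
    field_simp
  have hpow : (n : ℝ) ^ (-e * p) ≤ (n : ℝ)⁻¹ := by
    rw [← Real.rpow_neg_one]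
    refine Real.rpow_le_rpow_of_exponent_le hn1 ?_
    have h1 : e * p = 1 + (1 / q).toReal * p := by rw [he]; field_simp
    have h2 : 0 ≤ (1 / q).toReal * p := mul_nonneg ENNReal.toReal_nonneg hp0.le
    linarith
  have hinv : 0 < (lam ^ p)⁻¹ := by positivity
  have hinv1 : (lam ^ p)⁻¹ < 1 := inv_lt_one_of_one_lt₀ hL
  have hrn : n * r ^ p ≤ 1 - (lam ^ p)⁻¹ := by
    calc n * r ^ p ≤ n * ((1 - (lam ^ p)⁻¹) * (n : ℝ)⁻¹) := by
          rw [hrp]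
          exact mul_le_mul_of_nonneg_left
            (mul_le_mul_of_nonneg_left hpow (by linarith)) hn0.le
      _ = 1 - (lam ^ p)⁻¹ := by field_simp
  have hr1 : r ^ p < 1 := by
    have := le_mul_of_one_le_left (Real.rpow_nonneg hr p) hn1
    linarith
  have hr_le : r ≤ 1 := by
    by_contra! hcon
    exact absurd (Real.one_lt_rpow hcon hp0) hr1.not_gt
  refine le_csSup ⟨1, fun x hx => hx.1.2⟩ ⟨⟨hr, hr_le⟩, fun f a hf => ?_⟩
  refine holBohrSum_id_le (fun z hz w hw => ?_) hr hp0 hlam0 hr1 hrn hf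
  exact (lqNorm_congr q hw).trans_lt hz

end BohrPaper
end
end

section
/- Let n ≥ 1, X a nonzero complex Banach space and λ > 1. Then, for U the identity operator on X, K_λ(𝔻ⁿ,1,X) = B_λ(𝔻ⁿ,1,X) ≥ (λ − 1)/λ · 1/n. -/
open scoped ENNReal Pointwise
open Filter

noncomputable section

namespace BohrPaper

lemma exists_forall_apply_lt {n : ℕ} (s : Finset (Fin n → ℕ)) :
    ∃ N : ℕ, 0 < N ∧ ∀ β ∈ s, ∀ j, β j < N := by
  refine ⟨s.sup (fun β => ∑ j, β j) + 1, Nat.succ_pos _, fun β hβ j => Nat.lt_succ_of_le ?_⟩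
  exact (Finset.single_le_sum (f := β) (fun _ _ => Nat.zero_le _) (Finset.mem_univ j)).trans
    (Finset.le_sup (f := fun β : Fin n → ℕ => ∑ j, β j) hβ)

lemma norm_mpow {n : ℕ} (z : Fin n → ℂ) (α : Fin n → ℕ) :
    ‖mpow z α‖ = ∏ j, ‖z j‖ ^ α j := by
  simp [mpow, norm_prod, norm_pow]

lemma norm_mpow_le {n : ℕ} {r : ℝ} {z : Fin n → ℂ} (hz : ∀ j, ‖z j‖ ≤ r)
    (α : Fin n → ℕ) : ‖mpow z α‖ ≤ ∏ j, r ^ α j := by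
  rw [norm_mpow]
  exact Finset.prod_le_prod (fun j _ => by positivity)
    fun j _ => pow_le_pow_left₀ (norm_nonneg _) (hz j) _

lemma norm_apply_le_of_mem_smul_polydisc {n : ℕ} {r : ℝ} (hr : 0 ≤ r) {z : Fin n → ℂ}
    (hz : z ∈ r • polydisc n) (j : Fin n) : ‖z j‖ ≤ r := by
  obtain ⟨w, hw, rfl⟩ := hz
  have := (hw j).le
  simpa [norm_smul, abs_of_nonneg hr] using mul_le_mul_of_nonneg_left this hr

/-- Discrete orthogonality of monomials on a torus of `N`-th roots of unity. -/
lemma sum_mpow_mul_inv_mpow_rootsOfUnity {n N : ℕ} {ω : ℂ} (hω : IsPrimitiveRoot ω N)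
    (hN : 0 < N) (t : ℝ) {α β : Fin n → ℕ} (hα : ∀ j, α j < N) (hβ : ∀ j, β j < N) :
    ∑ k ∈ Fintype.piFinset fun _ : Fin n => Finset.range N,
        mpow (fun j => (t : ℂ) * ω ^ k j) β * (mpow (fun j => ω ^ k j) α)⁻¹ =
      if β = α then (N : ℂ) ^ n * ∏ j, (t : ℂ) ^ α j else 0 := by
  have hω0 : ω ≠ 0 := hω.ne_zero hN.ne'
  have key : ∀ j, ∑ k ∈ Finset.range N, ((t : ℂ) * ω ^ k) ^ β j * ((ω ^ k) ^ α j)⁻¹ =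
      if β j = α j then (N : ℂ) * (t : ℂ) ^ α j else 0 := by
    intro j
    have h1 : ∀ k, ((t : ℂ) * ω ^ k) ^ β j * ((ω ^ k) ^ α j)⁻¹ =
        (t : ℂ) ^ β j * (ω ^ β j * (ω ^ α j)⁻¹) ^ k := by
      intro k
      rw [mul_pow, mul_pow, inv_pow, ← pow_mul, ← pow_mul, ← pow_mul, ← pow_mul,
        mul_comm k, mul_comm k, mul_assoc]
    simp_rw [h1, ← Finset.mul_sum]
    split_ifs with h
    · simp [h, hω0, mul_comm]
    · have hne : ω ^ β j * (ω ^ α j)⁻¹ ≠ 1 := by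
        intro h2
        rw [mul_inv_eq_one₀ (pow_ne_zero _ hω0)] at h2
        exact h (hω.pow_inj (hβ j) (hα j) h2)
      rw [geom_sum_eq hne, mul_pow, inv_pow, ← pow_mul, ← pow_mul, mul_comm (β j),
        mul_comm (α j), pow_mul, pow_mul, hω.pow_eq_one]
      simp
  simp_rw [mpow, ← Finset.prod_inv_distrib, ← Finset.prod_mul_distrib]
  rw [← Finset.prod_univ_sum (fun _ => Finset.range N)
    fun j k => ((t : ℂ) * ω ^ k) ^ β j * ((ω ^ k) ^ α j)⁻¹]
  simp_rw [key]
  split_ifs with h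
  · simp [h, Finset.prod_mul_distrib]
  · obtain ⟨j, hj⟩ := Function.ne_iff.mp h
    exact Finset.prod_eq_zero (Finset.mem_univ j) (if_neg hj)

section Holomorphic

variable {n : ℕ} {X : Type*} [NormedAddCommGroup X] [NormedSpace ℂ X]

/-- Cauchy estimate for a polynomial on a torus. -/
lemma norm_coeff_mul_le_of_norm_sum_le (s : Finset (Fin n → ℕ)) (a : (Fin n → ℕ) → X)
    {t C : ℝ} (ht : 0 ≤ t)
    (hC : ∀ z : Fin n → ℂ, (∀ j, ‖z j‖ = t) → ‖∑ β ∈ s, mpow z β • a β‖ ≤ C)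
    {α : Fin n → ℕ} (hα : α ∈ s) : (∏ j, t ^ α j) * ‖a α‖ ≤ C := by
  obtain ⟨N, hN0, hN⟩ := exists_forall_apply_lt s
  have hω := Complex.isPrimitiveRoot_exp N hN0.ne'
  set ω := Complex.exp (2 * Real.pi * Complex.I / N)
  have hω1 : ‖ω‖ = 1 := hω.norm'_eq_one hN0.ne'
  set T := Fintype.piFinset fun _ : Fin n => Finset.range N with hT
  have hcard : (T.card : ℝ) = (N : ℝ) ^ n := by simp [hT]
  have hid : ∑ k ∈ T, (mpow (fun j => ω ^ k j) α)⁻¹ •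
      ∑ β ∈ s, mpow (fun j => (t : ℂ) * ω ^ k j) β • a β =
      ((N : ℂ) ^ n * ∏ j, (t : ℂ) ^ α j) • a α := by
    simp_rw [Finset.smul_sum, smul_smul]
    rw [Finset.sum_comm]
    simp_rw [← Finset.sum_smul]
    rw [Finset.sum_eq_single_of_mem α hα]
    · congr 1
      simp_rw [mul_comm (mpow _ α)⁻¹]
      rw [sum_mpow_mul_inv_mpow_rootsOfUnity hω hN0 t (hN α hα) (hN α hα), if_pos rfl]
    · intro β hβ hne
      simp_rw [mul_comm (mpow _ α)⁻¹]
      rw [sum_mpow_mul_inv_mpow_rootsOfUnity hω hN0 t (hN α hα) (hN β hβ), if_neg hne, zero_smul]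
  have hle := congrArg norm hid
  rw [norm_smul, norm_mul, norm_prod] at hle
  simp only [norm_pow, Complex.norm_natCast, Complex.norm_real, Real.norm_eq_abs,
    abs_of_nonneg ht] at hle
  have hbound : ‖∑ k ∈ T, (mpow (fun j => ω ^ k j) α)⁻¹ •
      ∑ β ∈ s, mpow (fun j => (t : ℂ) * ω ^ k j) β • a β‖ ≤ (N : ℝ) ^ n * C := by
    rw [← hcard, ← nsmul_eq_mul]
    refine (norm_sum_le_of_le _ fun k _ => ?_).trans_eq (Finset.sum_const C)
    rw [norm_smul, norm_inv, norm_mpow]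
    simp only [norm_pow, hω1, one_pow, Finset.prod_const_one, inv_one, one_mul]
    exact hC _ fun j => by simp [hω1, abs_of_nonneg ht]
  rw [hle, mul_assoc] at hbound
  exact le_of_mul_le_mul_left hbound (by positivity)

/-- Cauchy estimate on the polydisc. -/
lemma norm_coeff_le_supNorm {f : (Fin n → ℂ) → X} {a : (Fin n → ℕ) → X}
    (h : IsBddHolomorphic (polydisc n) f a) (α : Fin n → ℕ) :
    ‖a α‖ ≤ supNorm (polydisc n) f := by
  have hsub : ∀ t < (1 : ℝ), Metric.closedBall (0 : Fin n → ℂ) t ⊆ polydisc n :=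
    fun t ht z hz j => ((norm_le_pi_norm z j).trans (mem_closedBall_zero_iff.mp hz)).trans_lt ht
  have hlt : ∀ t ∈ Set.Ioo (0 : ℝ) 1, (∏ j, t ^ α j) * ‖a α‖ ≤ supNorm (polydisc n) f := by
    intro t ht
    refine le_of_forall_pos_le_add fun ε hε => ?_
    have hu := (tendstoLocallyUniformlyOn_iff_tendstoUniformlyOn_of_compact
      (isCompact_closedBall (0 : Fin n → ℂ) t)).mp (h.1.mono (hsub t ht.2))
    obtain ⟨s, hs, hαs⟩ :=
      ((Metric.tendstoUniformlyOn_iff.mp hu ε hε).and (eventually_ge_atTop {α})).exists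
    refine norm_coeff_mul_le_of_norm_sum_le s a ht.1.le (fun z hz => ?_)
      (Finset.singleton_subset_iff.mp hαs)
    have hzb : z ∈ Metric.closedBall (0 : Fin n → ℂ) t :=
      mem_closedBall_zero_iff.mpr ((pi_norm_le_iff_of_nonneg ht.1.le).mpr fun j => (hz j).le)
    have h1 := hs z hzb
    rw [dist_comm, dist_eq_norm] at h1
    have h2 := norm_le_supNorm h.2 (hsub t ht.2 hzb)
    have h3 := norm_le_norm_add_norm_sub' (∑ β ∈ s, mpow z β • a β) (f z)
    linarith
  have hcont : Continuous fun t : ℝ => (∏ j, t ^ α j) * ‖a α‖ := by fun_prop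
  have htend := (hcont.tendsto 1).mono_left (nhdsWithin_le_nhds (s := Set.Iio 1))
  simp only [one_pow, Finset.prod_const_one, one_mul] at htend
  exact le_of_tendsto htend (eventually_of_mem (Ioo_mem_nhdsLT one_pos) hlt)

variable {Y : Type*} [NormedAddCommGroup Y] [NormedSpace ℂ Y]

lemma holBohrSum_polydisc_one_le {r : ℝ} (hr : 0 ≤ r) (U : X →L[ℂ] Y) (a : (Fin n → ℕ) → X) :
    holBohrSum (polydisc n) r 1 U a ≤
      ∑' α : Fin n → ℕ, ENNReal.ofReal (‖U (a α)‖ * ∏ j, r ^ α j) := by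
  refine ENNReal.tsum_le_tsum fun α => iSup₂_le fun z hz => ENNReal.ofReal_le_ofReal ?_
  simp only [Real.rpow_one]
  gcongr
  exact norm_mpow_le (norm_apply_le_of_mem_smul_polydisc hr hz) α

/-- On the polydisc, the suprema in the second Bohr sum are approached simultaneously. -/
lemma iSup_tsum_polydisc_eq_holBohrSum {r : ℝ} (hr : 0 ≤ r) (U : X →L[ℂ] Y)
    (a : (Fin n → ℕ) → X) :
    (⨆ z ∈ r • polydisc n, ∑' α : Fin n → ℕ,
        ENNReal.ofReal (‖U (a α)‖ ^ (1 : ℝ) * ‖mpow z α‖ ^ (1 : ℝ))) =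
      holBohrSum (polydisc n) r 1 U a := by
  refine le_antisymm (iSup₂_le fun z hz => ENNReal.tsum_le_tsum fun α =>
    le_iSup₂ (f := fun z _ => ENNReal.ofReal (‖U (a α)‖ ^ (1 : ℝ) * ‖mpow z α‖ ^ (1 : ℝ))) z hz) ?_
  refine (holBohrSum_polydisc_one_le hr U a).trans ?_
  rw [ENNReal.tsum_eq_iSup_sum]
  refine iSup_le fun s => ?_
  have hcont : Continuous fun t : ℝ =>
      ∑ α ∈ s, ENNReal.ofReal (‖U (a α)‖ * ∏ j, (r * t) ^ α j) :=
    continuous_finsetSum _ fun α _ => ENNReal.continuous_ofReal.comp (by fun_prop)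
  have htend := (hcont.tendsto 1).mono_left (nhdsWithin_le_nhds (s := Set.Iio 1))
  simp only [mul_one] at htend
  refine le_of_tendsto htend (eventually_of_mem (Ioo_mem_nhdsLT one_pos) fun t ht => ?_)
  have hmem : (r • fun _ => (t : ℂ) : Fin n → ℂ) ∈ r • polydisc n :=
    Set.smul_mem_smul_set fun j => by simpa [abs_of_pos ht.1] using ht.2
  refine le_trans ?_ (le_iSup₂ _ hmem)
  refine le_trans (le_of_eq ?_) (ENNReal.sum_le_tsum s)
  refine Finset.sum_congr rfl fun α _ => ?_
  simp [norm_mpow, abs_of_pos ht.1, abs_of_nonneg hr]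

end Holomorphic

lemma sum_prod_pow_le {n : ℕ} {r : ℝ} (hr0 : 0 ≤ r) (hr1 : r < 1) (s : Finset (Fin n → ℕ)) :
    ∑ α ∈ s, ∏ j, r ^ α j ≤ ((1 - r)⁻¹) ^ n := by
  obtain ⟨N, -, hN⟩ := exists_forall_apply_lt s
  have hsub : s ⊆ Fintype.piFinset fun _ : Fin n => Finset.range N := fun β hβ =>
    Fintype.mem_piFinset.mpr fun j => Finset.mem_range.mpr (hN β hβ j)
  refine (Finset.sum_le_sum_of_subset_of_nonneg hsub fun _ _ _ => by positivity).trans ?_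
  rw [← Finset.prod_univ_sum (fun _ => Finset.range N) fun _ k => r ^ k, Finset.prod_const,
    Finset.card_univ, Fintype.card_fin]
  refine pow_le_pow_left₀ (by positivity) ?_ n
  rw [← tsum_geometric_of_lt_one hr0 hr1]
  exact (summable_geometric_of_lt_one hr0 hr1).sum_le_tsum _ fun _ _ => by positivity

/-- on the polydisc, first and second Bohr radii coincide for `p = 1` and the
identity operator, and are at least `(λ-1)/(λ n)`. -/
theorem first_eq_second_bohr_Hol_polydisc {n : ℕ} (hn : 1 ≤ n)
    {X : Type*} [NormedAddCommGroup X] [NormedSpace ℂ X] [CompleteSpace X] [Nontrivial X]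
    (lam : ℝ) (hlam : 1 < lam) :
    firstBohrHol (polydisc n) 1 lam (ContinuousLinearMap.id ℂ X) =
        secondBohrHol (polydisc n) 1 lam (ContinuousLinearMap.id ℂ X) ∧
      (lam - 1) / lam * (1 / (n : ℝ)) ≤
        secondBohrHol (polydisc n) 1 lam (ContinuousLinearMap.id ℂ X) := by
  constructor
  · refine congrArg sSup (Set.ext fun r => and_congr_right fun hr => ?_)
    simp_rw [iSup_tsum_polydisc_eq_holBohrSum hr.1]
  have hn1 : (1 : ℝ) ≤ n := by exact_mod_cast hn
  have hlam0 : 0 < lam := one_pos.trans hlam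
  set r := (lam - 1) / lam * (1 / (n : ℝ)) with hr
  have hr0 : 0 ≤ r := mul_nonneg (div_nonneg (by linarith) hlam0.le) (by positivity)
  have hnr : n * r = 1 - lam⁻¹ := by
    rw [hr]
    field_simp
  have hr1 : r < 1 := by
    have := inv_pos.mpr hlam0
    nlinarith
  have hpow : ((1 - r)⁻¹) ^ n ≤ lam := by
    have h := one_add_mul_le_pow (a := -r) (by linarith) n
    rw [inv_pow]
    refine inv_le_of_inv_le₀ hlam0 ?_
    rw [← sub_eq_add_neg] at h
    linarith
  refine le_csSup ⟨1, fun x hx => hx.1.2⟩ ⟨⟨hr0, hr1.le⟩, fun f a h => ?_⟩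
  refine (holBohrSum_polydisc_one_le hr0 _ a).trans ?_
  rw [ENNReal.tsum_eq_iSup_sum]
  refine iSup_le fun s => ?_
  rw [← ENNReal.ofReal_sum_of_nonneg fun _ _ => by positivity]
  refine ENNReal.ofReal_le_ofReal ?_
  simp only [Real.rpow_one, ContinuousLinearMap.id_apply]
  have hM : 0 ≤ supNorm (polydisc n) f := (norm_nonneg _).trans (norm_coeff_le_supNorm h 0)
  calc ∑ α ∈ s, ‖a α‖ * ∏ j, r ^ α j
      ≤ ∑ α ∈ s, supNorm (polydisc n) f * ∏ j, r ^ α j :=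
        Finset.sum_le_sum fun α _ =>
          mul_le_mul_of_nonneg_right (norm_coeff_le_supNorm h α) (by positivity)
    _ = (∑ α ∈ s, ∏ j, r ^ α j) * supNorm (polydisc n) f := by
        rw [← Finset.mul_sum, mul_comm]
    _ ≤ lam * supNorm (polydisc n) f :=
        mul_le_mul_of_nonneg_right ((sum_prod_pow_le hr0 hr1 s).trans hpow) hM

end BohrPaper
end
end
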